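/- Let μ, V : ℝ → ℝ be C³ on an open set where μ > 0 and V' ≠ 0. Define A = 6V·V''² − 3V'²·V'' − 2V·V'·V''', B = 6V·V'·V'' − 3V'³, and C = 2V·V'². Then the pointwise identity A·√μ − B·(√μ)' + C·(√μ)'' = V'⁴ · N holds on that set, where N = ((V/V'²)·√μ)'' + ((V/V'²)·(√μ)')'. -/

import Mathlib

/-- The function `N(x) = ((V/V'²)·√μ)'' + ((V/V'²)·(√μ)')'`. -/
noncomputable def NFun (μ V : ℝ → ℝ) (x : ℝ) : ℝ :=
  deriv (deriv (fun y => (V y / (deriv V y) ^ 2) * Real.sqrt (μ y))) x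
    + deriv (fun y => (V y / (deriv V y) ^ 2) * deriv (fun z => Real.sqrt (μ z)) y) x

/-- On an open set where `V` is `C²` and `V' ≠ 0`, the first derivative of `V / V'²`. -/
theorem hasDerivAt_div_deriv_sq {V : ℝ → ℝ} {s : Set ℝ} (hs : IsOpen s)
    (hV : ContDiffOn ℝ 2 V s) (hV' : ∀ x ∈ s, deriv V x ≠ 0) {x : ℝ} (hx : x ∈ s) :
    HasDerivAt (fun y => V y / (deriv V y) ^ 2)
      (1 / deriv V x - 2 * V x * deriv (deriv V) x / (deriv V x) ^ 3) x := by
  have h0 := ((hV.differentiableOn (by norm_num)).differentiableAt (hs.mem_nhds hx)).hasDerivAt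
  have hV1 : ContDiffOn ℝ 1 (deriv V) s := hV.deriv_of_isOpen hs (by norm_num)
  have h1 := ((hV1.differentiableOn (by norm_num)).differentiableAt (hs.mem_nhds hx)).hasDerivAt
  have hne := hV' x hx
  refine HasDerivAt.congr_deriv (h0.div (h1.pow 2) (pow_ne_zero 2 hne)) ?_
  field_simp
  ring

/-- The second derivative of `V / V'²`, in the form given by `hasDerivAt_div_deriv_sq`. -/
theorem hasDerivAt_deriv_div_deriv_sq {V : ℝ → ℝ} {s : Set ℝ} (hs : IsOpen s)
    (hV : ContDiffOn ℝ 3 V s) (hV' : ∀ x ∈ s, deriv V x ≠ 0) {x : ℝ} (hx : x ∈ s) :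
    HasDerivAt (fun y => 1 / deriv V y - 2 * V y * deriv (deriv V) y / (deriv V y) ^ 3)
      ((6 * V x * (deriv (deriv V) x) ^ 2 - 3 * (deriv V x) ^ 2 * deriv (deriv V) x
          - 2 * V x * deriv V x * deriv (deriv (deriv V)) x) / (deriv V x) ^ 4) x := by
  have h0 := ((hV.differentiableOn (by norm_num)).differentiableAt (hs.mem_nhds hx)).hasDerivAt
  have hV1 : ContDiffOn ℝ 2 (deriv V) s := hV.deriv_of_isOpen hs (by norm_num)
  have h1 := ((hV1.differentiableOn (by norm_num)).differentiableAt (hs.mem_nhds hx)).hasDerivAt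
  have hV2 : ContDiffOn ℝ 1 (deriv (deriv V)) s := hV1.deriv_of_isOpen hs (by norm_num)
  have h2 := ((hV2.differentiableOn (by norm_num)).differentiableAt (hs.mem_nhds hx)).hasDerivAt
  have hne := hV' x hx
  refine HasDerivAt.congr_deriv (((hasDerivAt_const x (1 : ℝ)).div h1 hne).sub
    (((h0.const_mul 2).mul h2).div (h1.pow 3) (pow_ne_zero 3 hne))) ?_
  simp only [Pi.mul_apply]
  field_simp
  ring

/-- The product rule for `(W g)'' + (W g')'`. -/
theorem deriv_deriv_mul_add_deriv_mul_deriv {W W' g : ℝ → ℝ} {W'' : ℝ} {s : Set ℝ}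
    (hs : IsOpen s) (hW : ∀ x ∈ s, HasDerivAt W (W' x) x) (hg : ContDiffOn ℝ 2 g s)
    {x : ℝ} (hx : x ∈ s) (hW' : HasDerivAt W' W'' x) :
    deriv (deriv fun y => W y * g y) x + deriv (fun y => W y * deriv g y) x
      = W'' * g x + 3 * W' x * deriv g x + 2 * W x * deriv (deriv g) x := by
  have hg0 : ∀ y ∈ s, HasDerivAt g (deriv g y) y := fun y hy =>
    ((hg.differentiableOn (by norm_num)).differentiableAt (hs.mem_nhds hy)).hasDerivAt
  have hg1 : ContDiffOn ℝ 1 (deriv g) s := hg.deriv_of_isOpen hs (by norm_num)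
  have hg2 := ((hg1.differentiableOn (by norm_num)).differentiableAt (hs.mem_nhds hx)).hasDerivAt
  have hprod : deriv (fun y => W y * g y) =ᶠ[nhds x] fun y => W' y * g y + W y * deriv g y := by
    filter_upwards [hs.mem_nhds hx] with y hy
    exact ((hW y hy).mul (hg0 y hy)).deriv
  have hleft : HasDerivAt (fun y => W' y * g y + W y * deriv g y)
      (W'' * g x + W' x * deriv g x + (W' x * deriv g x + W x * deriv (deriv g) x)) x :=
    (hW'.mul (hg0 x hx)).add ((hW x hx).mul hg2)
  have hright : HasDerivAt (fun y => W y * deriv g y)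
      (W' x * deriv g x + W x * deriv (deriv g) x) x := (hW x hx).mul hg2
  rw [hprod.deriv_eq, hleft.deriv, hright.deriv]
  ring

/-- The identity `A·√μ − B·(√μ)' + C·(√μ)'' = V'⁴·N` with
`A = 6VV''² − 3V'²V'' − 2VV'V'''`, `B = 6VV'V'' − 3V'³`, `C = 2VV'²`. -/
theorem ABC_identity
    (μ V : ℝ → ℝ) (s : Set ℝ) (hs : IsOpen s)
    (hμ : ContDiffOn ℝ 3 μ s) (hV : ContDiffOn ℝ 3 V s)
    (hμpos : ∀ x ∈ s, 0 < μ x) (hV' : ∀ x ∈ s, deriv V x ≠ 0) :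
    ∀ x ∈ s,
      (6 * V x * (deriv (deriv V) x) ^ 2 - 3 * (deriv V x) ^ 2 * deriv (deriv V) x
          - 2 * V x * deriv V x * deriv (deriv (deriv V)) x) * Real.sqrt (μ x)
        - (6 * V x * deriv V x * deriv (deriv V) x - 3 * (deriv V x) ^ 3)
            * deriv (fun y => Real.sqrt (μ y)) x
        + (2 * V x * (deriv V x) ^ 2) * deriv (deriv (fun y => Real.sqrt (μ y))) x
      = (deriv V x) ^ 4 * NFun μ V x := by
  intro x hx
  have hg : ContDiffOn ℝ 2 (fun y => Real.sqrt (μ y)) s :=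
    (hμ.of_le (by norm_num)).sqrt fun y hy => (hμpos y hy).ne'
  have hV2 : ContDiffOn ℝ 2 V s := hV.of_le (by norm_num)
  have hne := hV' x hx
  rw [NFun, deriv_deriv_mul_add_deriv_mul_deriv hs
    (fun y hy => hasDerivAt_div_deriv_sq hs hV2 hV' hy) hg hx
    (hasDerivAt_deriv_div_deriv_sq hs hV hV' hx)]
  field_simp
  ring
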